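/- At least quadratic complexity from the rational LP (unbounded case): Let V be a connected terminating VASS of dimension n and consider the linear program (C) over ℚ: maximize 1^T ρ subject to ρ ∈ ℚ^{Trns(V)}, ρ ≥ 0, Dρ ≥ -1 (componentwise), and Fρ = 0. If (C) is unbounded, then the computational complexity of V is at least quadratic, i.e., comp_N(V) ∈ Ω(N^2): there is a constant C > 0 such that comp_N(V) ≥ C·N^2 for all sufficiently large N. -/

import Mathlib

namespace VASSPaper

abbrev Val (n : ℕ) := Fin n → ℕ
abbrev Upd (n : ℕ) := Fin n → ℤ
abbrev Transition (n : ℕ) (L : Type) := L × Upd n × L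

/-- A vector addition system with states: a finite set of locations and a finite
set of transitions between locations, labelled by integer update vectors. -/
structure VASS (n : ℕ) (L : Type) where
  Locs : Finset L
  Trns : Finset (Transition n L)
  valid : ∀ t ∈ Trns, t.1 ∈ Locs ∧ t.2.2 ∈ Locs

variable {n : ℕ} {L : Type}

/-- A step of the VASS: the transition is in the system and the (non-negative)
valuation is updated by the update vector. -/
def Step (V : VASS n L) (s : L × Val n) (d : Upd n) (s' : L × Val n) : Prop :=
  (s.1, d, s'.1) ∈ V.Trns ∧ ∀ i, (s'.2 i : ℤ) = (s.2 i : ℤ) + d i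

/-- An infinite trace. -/
def InfTrace (V : VASS n L) (ℓ : ℕ → L) (v : ℕ → Val n) (d : ℕ → Upd n) : Prop :=
  ∀ i, Step V (ℓ i, v i) (d i) (ℓ (i + 1), v (i + 1))

/-- A finite trace of length `k`. -/
def FinTrace (V : VASS n L) (k : ℕ) (ℓ : ℕ → L) (v : ℕ → Val n) (d : ℕ → Upd n) : Prop :=
  ∀ i < k, Step V (ℓ i, v i) (d i) (ℓ (i + 1), v (i + 1))

/-- `V` is terminating if it has no infinite trace. -/
def Terminating (V : VASS n L) : Prop := ¬ ∃ ℓ v d, InfTrace V ℓ v d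

/-- A path, given as a list of transitions of `V` with matching endpoints. -/
def IsPath (V : VASS n L) (π : List (Transition n L)) : Prop :=
  (∀ t ∈ π, t ∈ V.Trns) ∧ π.Chain' (fun t₁ t₂ => t₁.2.2 = t₂.1)

/-- The value of a path: the sum of its update vectors. -/
def pathVal (π : List (Transition n L)) : Upd n := (π.map (fun t => t.2.1)).sum

/-- A cycle: a non-empty path whose start location equals its end location. -/
def IsCycle (V : VASS n L) (π : List (Transition n L)) : Prop :=
  IsPath V π ∧ π ≠ [] ∧ π.head?.map (fun t => t.1) = π.getLast?.map (fun t => t.2.2)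

/-- A multi-cycle: a finite collection of cycles. -/
def IsMultiCycle (V : VASS n L) (M : List (List (Transition n L))) : Prop :=
  ∀ C ∈ M, IsCycle V C

/-- The value of a multi-cycle: the sum of the values of its cycles. -/
def multiVal (M : List (List (Transition n L))) : Upd n := (M.map pathVal).sum

/-- A state is `N`-bounded if each component of its valuation is at most `N`. -/
def NBounded (V : VASS n L) (N : ℕ) (s : L × Val n) : Prop :=
  s.1 ∈ V.Locs ∧ ∀ i, s.2 i ≤ N

/-- `s'` is reachable from `s` by a finite trace. -/
def ReachableFrom (V : VASS n L) (s s' : L × Val n) : Prop :=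
  ∃ k ℓ v d, FinTrace V k ℓ v d ∧ (ℓ 0, v 0) = s ∧ (ℓ k, v k) = s'

/-- The computational complexity: the length of the longest trace starting in an
`N`-bounded state. -/
noncomputable def compN (V : VASS n L) (N : ℕ) : ℕ :=
  sSup { k | ∃ ℓ v d, NBounded V N (ℓ 0, v 0) ∧ FinTrace V k ℓ v d }

/-- A quasi-ranking function: weakly decreasing along every step. -/
def QuasiRanking (V : VASS n L) (q : L × Val n → ℕ) : Prop :=
  ∀ s d s', Step V s d s' → q s' ≤ q s

/-- `q` is ranking for transition `t`: strictly decreasing along every step taken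
along `t`. -/
def RankingFor (V : VASS n L) (q : L × Val n → ℕ) (t : Transition n L) : Prop :=
  ∀ s d s', Step V s d s' → (s.1, d, s'.1) = t → q s' < q s

/-- The (strict) lexicographic order on finite sequences of naturals, as in the paper:
`x >lex y` iff there is an index (within both sequences) where `x` is larger and all
earlier entries agree. -/
def LexGt (x y : List ℕ) : Prop :=
  ∃ i, i < x.length ∧ i < y.length ∧ y.getD i 0 < x.getD i 0 ∧
    ∀ j < i, x.getD j 0 = y.getD j 0

/-- A lexicographic ranking function of order `k` for `V`. -/
def IsLexRankingOfOrder (V : VASS n L) (k : ℕ) (f : L × Val n → List ℕ) : Prop :=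
  (∀ s : L × Val n, s.1 ∈ V.Locs → (f s).length ≤ k) ∧
  ∀ s d s', Step V s d s' → LexGt (f s) (f s')

def SubVASS (S V : VASS n L) : Prop := S.Locs ⊆ V.Locs ∧ S.Trns ⊆ V.Trns

/-- There is a path (possibly empty) from `l` to `l'`. -/
def Reaches (V : VASS n L) (l l' : L) : Prop :=
  Relation.ReflTransGen (fun a b => ∃ d, (a, d, b) ∈ V.Trns) l l'

/-- `V` is connected: every location can reach every other location. -/
def ConnectedV (V : VASS n L) : Prop :=
  ∀ l ∈ V.Locs, ∀ l' ∈ V.Locs, Reaches V l l'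

/-- A strongly connected component: a maximal connected sub-VASS. -/
def IsSCC (V S : VASS n L) : Prop :=
  SubVASS S V ∧ ConnectedV S ∧
    ∀ S', SubVASS S' V → ConnectedV S' → SubVASS S S' → SubVASS S' S

/-- `V` can be fully decomposed into SCCs: every transition belongs to some SCC. -/
def FullyDecomposable (V : VASS n L) : Prop :=
  ∀ t ∈ V.Trns, ∃ S, IsSCC V S ∧ t ∈ S.Trns

/-- The Kosaraju–Sullivan constraints (1)–(3): `Dμ ≥ 0`, `μ ≥ 0` and `Fμ = 0`
(the latter written out entrywise, with the oriented incidence matrix). -/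
def NonNegCombo [DecidableEq L] (V : VASS n L) (μ : Transition n L → ℤ) : Prop :=
  (∀ i : Fin n, 0 ≤ ∑ t ∈ V.Trns, t.2.1 i * μ t) ∧
  (∀ t ∈ V.Trns, 0 ≤ μ t) ∧
  (∀ l ∈ V.Locs,
    ∑ t ∈ V.Trns, ((if t.1 = l then (1 : ℤ) else 0) - (if t.2.2 = l then 1 else 0)) * μ t = 0)

/-- Constraint system (A_t). -/
def SatA [DecidableEq L] (V : VASS n L) (t₀ : Transition n L) : Prop :=
  ∃ μ : Transition n L → ℤ, NonNegCombo V μ ∧ 1 ≤ μ t₀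

/-- Constraint system (B_t): `r ≥ 0`, `z ≥ 0` and `Dᵀr + Fᵀz ≤ 0`, with strict
inequality in row `t₀` (the row of `Fᵀz` at a transition `t` is `z(src t) - z(tgt t)`). -/
def SatB (V : VASS n L) (t₀ : Transition n L) : Prop :=
  ∃ (r : Fin n → ℤ) (z : L → ℤ),
    (∀ i, 0 ≤ r i) ∧ (∀ l ∈ V.Locs, 0 ≤ z l) ∧
    (∀ t ∈ V.Trns, (∑ i, t.2.1 i * r i) + z t.1 - z t.2.2 ≤ 0) ∧
    (∑ i, t₀.2.1 i * r i) + z t₀.1 - z t₀.2.2 < 0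

/-- The cone of cycle values of `V` (over ℚ). -/
def coneSet [DecidableEq L] (V : VASS n L) : Set (Fin n → ℚ) :=
  { x | ∃ μ : Transition n L → ℚ, (∀ t ∈ V.Trns, 0 ≤ μ t) ∧
      (∀ l ∈ V.Locs,
        ∑ t ∈ V.Trns, ((if t.1 = l then (1 : ℚ) else 0) - (if t.2.2 = l then 1 else 0)) * μ t = 0) ∧
      x = fun i => ∑ t ∈ V.Trns, (t.2.1 i : ℚ) * μ t }

/-- The dimension of the smallest vector space containing the cone of `V`. -/
noncomputable def coneDim [DecidableEq L] (V : VASS n L) : ℕ :=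
  Module.finrank ℚ (Submodule.span ℚ (coneSet V))

/-- Conservative VASS: the entries of each update vector sum to zero. -/
def Conservative (V : VASS n L) : Prop := ∀ t ∈ V.Trns, ∑ i, t.2.1 i = 0

/-- The feasible region of the rational LP (C): `ρ ≥ 0`, `Dρ ≥ -1`, `Fρ = 0`. -/
def FeasC [DecidableEq L] (V : VASS n L) (ρ : Transition n L → ℚ) : Prop :=
  (∀ t ∈ V.Trns, 0 ≤ ρ t) ∧
  (∀ i : Fin n, (-1 : ℚ) ≤ ∑ t ∈ V.Trns, (t.2.1 i : ℚ) * ρ t) ∧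
  (∀ l ∈ V.Locs,
    ∑ t ∈ V.Trns, ((if t.1 = l then (1 : ℚ) else 0) - (if t.2.2 = l then 1 else 0)) * ρ t = 0)

lemma exists_nat_recession {T J : Type*} [Finite J] (s : Finset T) (A : J → T → ℤ)
    (h : ∀ M : ℚ, ∃ ρ : T → ℚ, (∀ t ∈ s, 0 ≤ ρ t) ∧
      (∀ j, (-1 : ℚ) ≤ ∑ t ∈ s, (A j t : ℚ) * ρ t) ∧ M ≤ ∑ t ∈ s, ρ t) :
    ∃ μ : T → ℕ, (∃ t ∈ s, 0 < μ t) ∧ ∀ j, 0 ≤ ∑ t ∈ s, A j t * (μ t : ℤ) := by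
  choose ρ h0 h1 h2 using fun k : ℕ => h k
  set m : ℕ → T → ℕ := fun k t => ⌊ρ k t⌋₊ with hm
  have hlow : ∀ k j, 0 ≤ ∑ t ∈ s, A j t * (m k t : ℤ) + (1 + ∑ t ∈ s, |A j t|) := by
    intro k j
    have hterm : ∀ t ∈ s, (A j t : ℚ) * ρ k t ≤ (A j t : ℚ) * (m k t : ℚ) + |(A j t : ℚ)| := by
      intro t ht
      have e1 := Nat.floor_le (h0 k t ht)
      have e2 := (Nat.lt_floor_add_one (ρ k t)).le
      have e3 : |ρ k t - (m k t : ℚ)| ≤ 1 := by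
        rw [abs_le]; constructor <;> simp only [hm] <;> linarith
      have e4 : (A j t : ℚ) * (ρ k t - (m k t : ℚ)) ≤ |(A j t : ℚ)| :=
        (le_abs_self _).trans (by
          rw [abs_mul]; exact mul_le_of_le_one_right (abs_nonneg _) e3)
      linarith
    have hsum := Finset.sum_le_sum hterm
    rw [Finset.sum_add_distrib] at hsum
    have h1' := h1 k j
    have : (0 : ℚ) ≤ ((∑ t ∈ s, A j t * (m k t : ℤ) + (1 + ∑ t ∈ s, |A j t|) : ℤ) : ℚ) := by
      push_cast
      linarith
    exact_mod_cast this
  have htend : Filter.Tendsto (fun k => ∑ t ∈ s, m k t) Filter.atTop Filter.atTop := by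
    refine Filter.tendsto_atTop_mono (fun k => ?_) (Filter.tendsto_sub_atTop_nat s.card)
    have : ∑ t ∈ s, ρ k t ≤ ∑ t ∈ s, ((m k t : ℚ) + 1) :=
      Finset.sum_le_sum fun t _ => (Nat.lt_floor_add_one (ρ k t)).le
    have h3 := (h2 k).trans this
    rw [Finset.sum_add_distrib] at h3
    simp only [Finset.sum_const, nsmul_eq_mul, mul_one] at h3
    rw [tsub_le_iff_right]
    exact_mod_cast h3
  obtain ⟨φ, -, hφ⟩ := Filter.strictMono_subseq_of_tendsto_atTop htend
  obtain ⟨a, b, hab, hle⟩ := wellQuasiOrdered_le (α := (s → ℕ) × (J → ℕ)) fun k =>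
    (fun t => m (φ k) t,
      fun j => (∑ t ∈ s, A j t * (m (φ k) t : ℤ) + (1 + ∑ t ∈ s, |A j t|)).toNat)
  obtain ⟨hle1, hle2⟩ := Prod.mk_le_mk.1 hle
  have hle1' : ∀ t ∈ s, m (φ a) t ≤ m (φ b) t := fun t ht => hle1 ⟨t, ht⟩
  refine ⟨fun t => m (φ b) t - m (φ a) t, ?_, fun j => ?_⟩
  · obtain ⟨t, ht, hlt⟩ := Finset.exists_lt_of_sum_lt (hφ hab)
    exact ⟨t, ht, Nat.sub_pos_of_lt hlt⟩
  · have hj : (_ : ℤ).toNat ≤ (_ : ℤ).toNat := hle2 j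
    have hja := hlow (φ a) j
    have hjb := hlow (φ b) j
    have : ∑ t ∈ s, A j t * ((m (φ b) t - m (φ a) t : ℕ) : ℤ)
        = ∑ t ∈ s, A j t * (m (φ b) t : ℤ) - ∑ t ∈ s, A j t * (m (φ a) t : ℤ) := by
      rw [← Finset.sum_sub_distrib]
      refine Finset.sum_congr rfl fun t ht => ?_
      rw [Nat.cast_sub (hle1' t ht)]; ring
    rw [this]
    omega

/-- `Walk V l π l'`: the list `π` of transitions of `V` is a walk from `l` to `l'`. -/
def Walk (V : VASS n L) : L → List (Transition n L) → L → Prop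
  | l, [], l' => l = l'
  | l, t :: π, l' => t ∈ V.Trns ∧ t.1 = l ∧ Walk V t.2.2 π l'

lemma Walk.append {V : VASS n L} {a b c : L} {π π' : List (Transition n L)}
    (h : Walk V a π b) (h' : Walk V b π' c) : Walk V a (π ++ π') c := by
  induction π generalizing a with
  | nil => cases h; exact h'
  | cons t π ih => exact ⟨h.1, h.2.1, ih h.2.2⟩

lemma Walk.mem_trns {V : VASS n L} {a b : L} {π : List (Transition n L)}
    (h : Walk V a π b) : ∀ t ∈ π, t ∈ V.Trns := by
  induction π generalizing a with
  | nil => simp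
  | cons t π ih => exact List.forall_mem_cons.2 ⟨h.1, ih h.2.2⟩

lemma pathVal_append (π π' : List (Transition n L)) :
    pathVal (π ++ π') = pathVal π + pathVal π' := by
  simp [pathVal]

lemma pathVal_cons (t : Transition n L) (π : List (Transition n L)) :
    pathVal (t :: π) = t.2.1 + pathVal π := by
  simp [pathVal]

lemma Reaches.exists_walk {V : VASS n L} {a b : L} (h : Reaches V a b) :
    ∃ π, Walk V a π b := by
  induction h using Relation.ReflTransGen.head_induction_on with
  | refl => exact ⟨[], rfl⟩
  | head h _ ih =>
    obtain ⟨d, hd⟩ := h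
    obtain ⟨π, hπ⟩ := ih
    exact ⟨(_, d, _) :: π, hd, rfl, hπ⟩

lemma Walk.exists_repeat {V : VASS n L} {a : L} {π : List (Transition n L)}
    (h : Walk V a π a) (k : ℕ) :
    ∃ π', Walk V a π' a ∧ π'.length = k * π.length ∧ pathVal π' = (k : ℤ) • pathVal π := by
  induction k with
  | zero => exact ⟨[], rfl, by simp, by simp [pathVal]⟩
  | succ k ih =>
    obtain ⟨π', hw, hl, hv⟩ := ih
    refine ⟨π' ++ π, hw.append h, ?_, ?_⟩
    · rw [List.length_append, hl]; ring
    · rw [pathVal_append, hv, Nat.cast_succ, add_smul, one_smul]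

lemma sum_map_eq_sum_mul_count [DecidableEq L] (s : Finset (Transition n L))
    (f : Transition n L → ℤ) (π : List (Transition n L)) (h : ∀ t ∈ π, t ∈ s) :
    (π.map f).sum = ∑ t ∈ s, f t * (π.count t : ℤ) := by
  induction π with
  | nil => simp
  | cons t π ih =>
    rw [List.map_cons, List.sum_cons, ih fun u hu => h u (List.mem_cons_of_mem _ hu)]
    have ht : t ∈ s := h t List.mem_cons_self
    simp only [List.count_cons, beq_iff_eq, Nat.cast_add, mul_add, Finset.sum_add_distrib]
    simp [ht, add_comm]

lemma Walk.sum_incidence [DecidableEq L] {V : VASS n L} {a b : L}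
    {π : List (Transition n L)} (h : Walk V a π b) (l : L) :
    (π.map fun t => (if t.1 = l then (1 : ℤ) else 0) - (if t.2.2 = l then 1 else 0)).sum
      = (if a = l then 1 else 0) - (if b = l then 1 else 0) := by
  induction π generalizing a with
  | nil => cases h; simp
  | cons t π ih =>
    obtain ⟨-, rfl, h⟩ := h
    rw [List.map_cons, List.sum_cons, ih h]
    ring

/-- A circulation `μ`: a weighting of the transitions that is balanced at every location. -/
def Balanced [DecidableEq L] (V : VASS n L) (μ : Transition n L → ℕ) : Prop :=
  ∀ l, ∑ t ∈ V.Trns, ((if t.1 = l then (1 : ℤ) else 0) - (if t.2.2 = l then 1 else 0)) * μ t = 0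

lemma Balanced.exists_next [DecidableEq L] {V : VASS n L} {μ : Transition n L → ℕ}
    (hμ : Balanced V μ) {t : Transition n L} (ht : t ∈ V.Trns) (hpos : 0 < μ t) :
    ∃ u ∈ V.Trns, 0 < μ u ∧ u.1 = t.2.2 := by
  by_contra! hne
  have hnonpos : ∀ u ∈ V.Trns, ((if u.1 = t.2.2 then (1 : ℤ) else 0)
      - (if u.2.2 = t.2.2 then 1 else 0)) * μ u ≤ 0 := by
    intro u hu
    by_cases h0 : μ u = 0
    · simp [h0]
    · rw [if_neg (hne u hu (Nat.pos_of_ne_zero h0))]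
      split_ifs <;> simp
  have := (Finset.sum_eq_zero_iff_of_nonpos hnonpos).1 (hμ t.2.2) t ht
  rw [if_neg (hne t ht hpos)] at this
  simp at this
  omega

lemma Balanced.exists_cycle [DecidableEq L] {V : VASS n L} {μ : Transition n L → ℕ}
    (hμ : Balanced V μ) {t : Transition n L} (ht : t ∈ V.Trns) (hpos : 0 < μ t) :
    ∃ a ∈ V.Locs, ∃ C, Walk V a C a ∧ C ≠ [] ∧ ∀ u, C.count u ≤ μ u := by
  let S := {u : Transition n L // u ∈ V.Trns ∧ 0 < μ u}
  have : Finite S :=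
    Finite.of_injective (fun u : S => (⟨u.1, u.2.1⟩ : V.Trns)) fun u w h =>
      Subtype.ext (congrArg (fun z : V.Trns => z.1) h)
  have hnext : ∀ u : S, ∃ w : S, w.1.1 = u.1.2.2 := fun u => by
    obtain ⟨w, hw, hwpos, h⟩ := hμ.exists_next u.2.1 u.2.2
    exact ⟨⟨w, hw, hwpos⟩, h⟩
  choose f hf using hnext
  obtain ⟨x, hx⟩ : ∃ x, x ∈ Function.periodicPts f := by
    obtain ⟨i, j, hij, he⟩ := Finite.exists_ne_map_eq_of_infinite
      (fun i : ℕ => f^[i] ⟨t, ht, hpos⟩)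
    wlog hlt : i < j generalizing i j
    · exact this j i hij.symm he.symm (by omega)
    refine ⟨f^[i] ⟨t, ht, hpos⟩, Function.mk_mem_periodicPts (Nat.sub_pos_of_lt hlt) ?_⟩
    rw [Function.IsPeriodicPt, Function.IsFixedPt, ← Function.iterate_add_apply,
      Nat.sub_add_cancel hlt.le]
    exact he.symm
  have hwalk : ∀ m, Walk V x.1.1 ((List.range m).map fun i => (f^[i] x).1) (f^[m] x).1.1 := by
    intro m
    induction m with
    | zero => rfl
    | succ m ih =>
      rw [List.range_succ, List.map_append]
      refine ih.append ⟨(f^[m] x).2.1, rfl, ?_⟩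
      rw [Function.iterate_succ_apply']
      exact (hf _).symm
  refine ⟨x.1.1, (V.valid _ x.2.1).1,
    (List.range (Function.minimalPeriod f x)).map fun i => (f^[i] x).1, ?_, ?_, ?_⟩
  · have := hwalk (Function.minimalPeriod f x)
    rwa [Function.iterate_minimalPeriod] at this
  · have := Function.minimalPeriod_pos_of_mem_periodicPts hx
    simp; omega
  · intro u
    by_cases hu : u ∈ (List.range (Function.minimalPeriod f x)).map fun i => (f^[i] x).1
    · rw [List.count_eq_one_of_mem _ hu]
      · obtain ⟨i, -, rfl⟩ := List.mem_map.1 hu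
        exact (f^[i] x).2.2
      · refine List.Nodup.map_on (fun i hi j hj h => ?_) List.nodup_range
        exact Function.iterate_injOn_Iio_minimalPeriod (List.mem_range.1 hi)
          (List.mem_range.1 hj) (Subtype.ext h)
    · rw [List.count_eq_zero_of_not_mem hu]
      exact Nat.zero_le _

/-- In a connected VASS, any multiple of a circulation is realised by a closed walk through a
given location, up to a fixed correction. -/
lemma Balanced.exists_closed_walk [DecidableEq L] {V : VASS n L} (hconn : ConnectedV V)
    {l₀ : L} (hl₀ : l₀ ∈ V.Locs) {μ : Transition n L → ℕ} (hμ : Balanced V μ) :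
    ∃ (c : ℕ) (X : Upd n), ∀ k : ℕ, ∃ π, Walk V l₀ π l₀ ∧
      π.length = c + k * ∑ t ∈ V.Trns, μ t ∧
      ∀ i, pathVal π i = X i + k * ∑ t ∈ V.Trns, t.2.1 i * (μ t : ℤ) := by
  induction hS : ∑ t ∈ V.Trns, μ t using Nat.strong_induction_on generalizing μ with
  | _ S ih =>
  by_cases hz : ∃ t ∈ V.Trns, 0 < μ t
  · obtain ⟨t, ht, hpos⟩ := hz
    obtain ⟨a, ha, C, hC, hne, hcount⟩ := hμ.exists_cycle ht hpos
    have hsub : ∀ t, ((μ t - C.count t : ℕ) : ℤ) = μ t - C.count t := fun t =>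
      Nat.cast_sub (hcount t)
    have hbal : Balanced V fun t => μ t - C.count t := by
      intro l
      have h1 := hC.sum_incidence l
      rw [sum_map_eq_sum_mul_count V.Trns _ C hC.mem_trns, sub_self] at h1
      simp only [hsub, mul_sub, Finset.sum_sub_distrib]
      rw [h1, hμ l, sub_zero]
    have hlen : ∑ t ∈ V.Trns, C.count t = C.length := by
      have := sum_map_eq_sum_mul_count V.Trns (fun _ => 1) C hC.mem_trns
      simp only [List.map_const', List.sum_replicate, one_mul, mul_one, nsmul_eq_mul] at this
      exact_mod_cast this.symm
    have hval : ∀ i, pathVal C i = ∑ t ∈ V.Trns, t.2.1 i * (C.count t : ℤ) := by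
      intro i
      rw [← sum_map_eq_sum_mul_count V.Trns (fun t => t.2.1 i) C hC.mem_trns]
      clear hC hne hcount hsub hbal hlen
      induction C with
      | nil => simp [pathVal]
      | cons t C ih => simp [pathVal_cons, ih]
    have hsum : ∑ t ∈ V.Trns, (μ t - C.count t) + C.length = S := by
      rw [← hlen, ← Finset.sum_add_distrib, ← hS]
      exact Finset.sum_congr rfl fun t _ => Nat.sub_add_cancel (hcount t)
    have hlt : ∑ t ∈ V.Trns, (μ t - C.count t) < S := by
      have := List.length_pos_iff.2 hne
      omega
    obtain ⟨c, X, hk⟩ := ih _ hlt hbal rfl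
    obtain ⟨p, hp⟩ := (hconn _ hl₀ _ ha).exists_walk
    obtain ⟨q, hq⟩ := (hconn _ ha _ hl₀).exists_walk
    refine ⟨p.length + q.length + c, pathVal p + pathVal q + X, fun k => ?_⟩
    obtain ⟨π, hπ, hπl, hπv⟩ := hk k
    obtain ⟨R, hR, hRl, hRv⟩ := hC.exists_repeat k
    refine ⟨p ++ (R ++ (q ++ π)), hp.append (hR.append (hq.append hπ)), ?_, fun i => ?_⟩
    · simp only [List.length_append, hπl, hRl, ← hsum]
      ring
    · simp only [pathVal_append, Pi.add_apply, hπv, hRv, Pi.smul_apply, smul_eq_mul, hval, hsub,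
        mul_sub, Finset.sum_sub_distrib]
      ring
  · push Not at hz
    have hz' : ∀ t ∈ V.Trns, μ t = 0 := fun t ht => Nat.le_zero.1 (hz t ht)
    refine ⟨0, 0, fun k => ⟨[], rfl, ?_, fun i => ?_⟩⟩
    · rw [← hS, Finset.sum_eq_zero hz']; rfl
    · rw [Finset.sum_eq_zero fun t ht => by rw [hz' t ht]; simp]
      simp [pathVal]

/-- `Run V k s s'`: there is a trace of length `k` from `s` to `s'`. -/
inductive Run (V : VASS n L) : ℕ → L × Val n → L × Val n → Prop
  | refl (s : L × Val n) : Run V 0 s s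
  | head {k : ℕ} {s s' s'' : L × Val n} {d : Upd n} :
      Step V s d s' → Run V k s' s'' → Run V (k + 1) s s''

lemma Run.append {V : VASS n L} {k m : ℕ} {s s' s'' : L × Val n}
    (h : Run V k s s') (h' : Run V m s' s'') : Run V (k + m) s s'' := by
  induction h with
  | refl => rwa [Nat.zero_add]
  | head hs _ ih => rw [Nat.add_right_comm]; exact .head hs (ih h')

lemma FinTrace.run {V : VASS n L} {k : ℕ} {ℓ : ℕ → L} {v : ℕ → Val n} {d : ℕ → Upd n}
    (h : FinTrace V k ℓ v d) : Run V k (ℓ 0, v 0) (ℓ k, v k) := by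
  induction k generalizing ℓ v d with
  | zero => exact .refl _
  | succ k ih =>
    exact .head (h 0 (Nat.succ_pos k)) (ih (ℓ := fun i => ℓ (i + 1)) (v := fun i => v (i + 1))
      (d := fun i => d (i + 1)) fun i hi => h (i + 1) (Nat.succ_lt_succ hi))

lemma Run.exists_finTrace {V : VASS n L} {k : ℕ} {s s' : L × Val n} (h : Run V k s s') :
    ∃ ℓ v d, FinTrace V k ℓ v d ∧ (ℓ 0, v 0) = s := by
  induction h with
  | refl s => exact ⟨fun _ => s.1, fun _ => s.2, fun _ => 0, fun i hi => by omega, rfl⟩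
  | @head k s s' s'' d hs _ ih =>
    obtain ⟨ℓ, v, e, htr, h0⟩ := ih
    refine ⟨fun i => Nat.casesOn i s.1 ℓ, fun i => Nat.casesOn i s.2 v,
      fun i => Nat.casesOn i d e, fun i hi => ?_, rfl⟩
    cases i with
    | zero =>
      change Step V s d (ℓ 0, v 0)
      rwa [h0]
    | succ i => exact htr i (Nat.lt_of_succ_lt_succ hi)

lemma Walk.exists_run {V : VASS n L} {K : ℕ} (hK : ∀ t ∈ V.Trns, ∀ i, -(K : ℤ) ≤ t.2.1 i)
    {a b : L} {π : List (Transition n L)} (h : Walk V a π b) {v : Val n}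
    (hv : ∀ i, K * π.length ≤ v i) :
    ∃ w : Val n, Run V π.length (a, v) (b, w) ∧ ∀ i, (w i : ℤ) = v i + pathVal π i := by
  induction π generalizing a v with
  | nil => cases h; exact ⟨v, .refl _, fun i => by simp [pathVal]⟩
  | cons t π ih =>
    obtain ⟨ht, rfl, h⟩ := h
    have hge : ∀ i, ((K * π.length : ℕ) : ℤ) ≤ v i + t.2.1 i := fun i => by
      have h1 := hK t ht i
      have h2 := hv i
      rw [List.length_cons, Nat.mul_succ] at h2
      zify at h2 ⊢
      linarith
    have hcast : ∀ i, (((v i + t.2.1 i).toNat : ℕ) : ℤ) = v i + t.2.1 i := fun i =>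
      Int.toNat_of_nonneg ((Int.natCast_nonneg _).trans (hge i))
    obtain ⟨w, hr, hw⟩ := ih h (v := fun i => (v i + t.2.1 i).toNat) fun i => by
      rw [← Int.ofNat_le, hcast]; exact hge i
    refine ⟨w, .head (d := t.2.1) ⟨ht, hcast⟩ hr, fun i => ?_⟩
    rw [hw, hcast, pathVal_cons, Pi.add_apply, add_assoc]

/-- A closed walk that decreases every component by at most `B` can be run `r` times in a row. -/
lemma Walk.exists_run_repeat {V : VASS n L} {K : ℕ}
    (hK : ∀ t ∈ V.Trns, ∀ i, -(K : ℤ) ≤ t.2.1 i) {a : L} {π : List (Transition n L)}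
    (h : Walk V a π a) {B : ℕ} (hB : ∀ i, -(B : ℤ) ≤ pathVal π i) (r : ℕ) {v : Val n}
    (hv : ∀ i, K * π.length + r * B ≤ v i) :
    ∃ w : Val n, Run V (r * π.length) (a, v) (a, w) := by
  induction r generalizing v with
  | zero => rw [Nat.zero_mul]; exact ⟨v, .refl _⟩
  | succ r ih =>
    obtain ⟨w, hr, hw⟩ := h.exists_run hK (v := v) fun i => (Nat.le_add_right _ _).trans (hv i)
    obtain ⟨w', hr'⟩ := ih (v := w) fun i => by
      have h1 := hv i
      have h2 := hw i
      have h3 := hB i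
      rw [Nat.succ_mul] at h1
      omega
    refine ⟨w', ?_⟩
    rw [Nat.succ_mul, Nat.add_comm]
    exact hr.append hr'

lemma Terminating.exists_run_bound {V : VASS n L} (hterm : Terminating V) (s : L × Val n) :
    ∃ B, ∀ k s', Run V k s s' → k ≤ B := by
  have hwf : WellFounded fun s' s : L × Val n => ∃ d, Step V s d s' := by
    rw [wellFounded_iff_isEmpty_descending_chain]
    refine ⟨fun ⟨f, hf⟩ => hterm ?_⟩
    choose d hd using hf
    exact ⟨fun i => (f i).1, fun i => (f i).2, d, hd⟩
  induction s using hwf.induction with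
  | _ s ih =>
  have hg : ∀ t : Transition n L, ∃ B, ∀ s', Step V s t.2.1 s' → s'.1 = t.2.2 →
      ∀ k s'', Run V k s' s'' → k ≤ B := by
    intro t
    by_cases hex : ∃ s', Step V s t.2.1 s' ∧ s'.1 = t.2.2
    · obtain ⟨s₁, hs₁, he₁⟩ := hex
      obtain ⟨B, hB⟩ := ih s₁ ⟨_, hs₁⟩
      refine ⟨B, fun s' hs' he' => ?_⟩
      have : s' = s₁ := Prod.ext (he'.trans he₁.symm) (funext fun i => by
        have h1 := hs'.2 i
        have h2 := hs₁.2 i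
        omega)
      rwa [this]
    · exact ⟨0, fun s' hs' he' => absurd ⟨s', hs', he'⟩ hex⟩
  choose g hg using hg
  refine ⟨∑ t ∈ V.Trns, g t + 1, fun k s' hr => ?_⟩
  cases hr with
  | refl => exact Nat.zero_le _
  | @head k _ s₁ _ d hs hr =>
    have h1 := hg (s.1, d, s₁.1) s₁ hs rfl _ _ hr
    have h2 := Finset.single_le_sum (f := g) (fun _ _ => Nat.zero_le _) hs.1
    omega

lemma finite_nBounded (V : VASS n L) (N : ℕ) : {s | NBounded V N s}.Finite :=
  (V.Locs.finite_toSet.prod (Set.finite_Iic (fun _ : Fin n => N))).subset fun _ hs => ⟨hs.1, hs.2⟩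

lemma Run.le_compN {V : VASS n L} (hterm : Terminating V) {N k : ℕ} {s s' : L × Val n}
    (hs : NBounded V N s) (h : Run V k s s') : k ≤ compN V N := by
  choose B hB using hterm.exists_run_bound
  obtain ⟨b, hb⟩ := ((finite_nBounded V N).image B).bddAbove
  refine le_csSup ⟨b, ?_⟩ ?_
  · rintro m ⟨ℓ, v, d, hN, htr⟩
    exact (hB _ _ _ htr.run).trans (hb ⟨_, hN, rfl⟩)
  · obtain ⟨ℓ, v, d, htr, h0⟩ := h.exists_finTrace
    exact ⟨ℓ, v, d, h0 ▸ hs, htr⟩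

/-- An unbounded LP (C) has a nonzero integral recession direction. -/
lemma exists_balanced_of_unbounded [DecidableEq L] (V : VASS n L)
    (hunb : ∀ M : ℚ, ∃ ρ, FeasC V ρ ∧ M ≤ ∑ t ∈ V.Trns, ρ t) :
    ∃ μ : Transition n L → ℕ, (∃ t ∈ V.Trns, 0 < μ t) ∧ Balanced V μ ∧
      ∀ i, 0 ≤ ∑ t ∈ V.Trns, t.2.1 i * (μ t : ℤ) := by
  let F : L → Transition n L → ℤ := fun l t =>
    (if t.1 = l then (1 : ℤ) else 0) - (if t.2.2 = l then 1 else 0)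
  let A : Fin n ⊕ V.Locs ⊕ V.Locs → Transition n L → ℤ :=
    Sum.elim (fun i t => t.2.1 i) (Sum.elim (fun l t => F l t) (fun l t => -F l t))
  obtain ⟨μ, hpos, hA⟩ := exists_nat_recession V.Trns A fun M => by
    obtain ⟨ρ, ⟨h0, h1, h2⟩, h3⟩ := hunb M
    refine ⟨ρ, h0, ?_, h3⟩
    rintro (i | l | l)
    · exact h1 i
    · have := h2 l l.2
      simp only [A, F, Sum.elim_inl, Sum.elim_inr]
      push_cast
      rw [this]
      norm_num
    · have := h2 l l.2
      simp only [A, F, Sum.elim_inr]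
      push_cast
      simp only [neg_mul, Finset.sum_neg_distrib]
      rw [this]
      norm_num
  refine ⟨μ, hpos, fun l => ?_, fun i => hA (.inl i)⟩
  by_cases hl : l ∈ V.Locs
  · have h1 := hA (.inr (.inl ⟨l, hl⟩))
    have h2 := hA (.inr (.inr ⟨l, hl⟩))
    simp only [A, Sum.elim_inr, Sum.elim_inl, neg_mul, Finset.sum_neg_distrib] at h1 h2
    exact le_antisymm (by simpa using h2) h1
  · refine Finset.sum_eq_zero fun t ht => ?_
    have h1 : t.1 ≠ l := fun h => hl (h ▸ (V.valid t ht).1)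
    have h2 : t.2.2 ≠ l := fun h => hl (h ▸ (V.valid t ht).2)
    simp [h1, h2]

/-- **At least quadratic complexity from the rational LP (unbounded case).** If the
LP (C) `max 1ᵀρ s.t. ρ ≥ 0, Dρ ≥ -1, Fρ = 0` over ℚ is unbounded for a connected
terminating VASS `V`, then `comp_N(V) ∈ Ω(N²)`. -/
theorem quadratic_lower_bound_from_unbounded_lp {n : ℕ} {L : Type} [DecidableEq L]
    (V : VASS n L) (hconn : ConnectedV V) (hterm : Terminating V)
    (hunb : ∀ M : ℚ, ∃ ρ, FeasC V ρ ∧ M ≤ ∑ t ∈ V.Trns, ρ t) :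
    ∃ C : ℝ, 0 < C ∧ ∃ N₀ : ℕ, ∀ N, N₀ ≤ N → C * (N : ℝ) ^ 2 ≤ (compN V N : ℝ) := by
  obtain ⟨μ, ⟨t₀, ht₀, hpos⟩, hbal, hD⟩ := exists_balanced_of_unbounded V hunb
  have hl₀ := (V.valid t₀ ht₀).1
  obtain ⟨c, X, hwalk⟩ := hbal.exists_closed_walk hconn hl₀
  set S := ∑ t ∈ V.Trns, μ t with hS
  have hSpos : 1 ≤ S :=
    hpos.trans_le (Finset.single_le_sum (f := μ) (fun _ _ => Nat.zero_le _) ht₀)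
  obtain ⟨K, hK⟩ : ∃ K : ℕ, ∀ t ∈ V.Trns, ∀ i, -(K : ℤ) ≤ t.2.1 i := by
    refine ⟨∑ t ∈ V.Trns, ∑ i, (t.2.1 i).natAbs, fun t ht i => ?_⟩
    have h1 := Finset.single_le_sum (f := fun t : Transition n L => ∑ i, (t.2.1 i).natAbs)
      (fun _ _ => Nat.zero_le _) ht
    have h2 := Finset.single_le_sum (f := fun i => (t.2.1 i).natAbs)
      (fun _ _ => Nat.zero_le _) (Finset.mem_univ i)
    omega
  obtain ⟨B, hB⟩ : ∃ B : ℕ, ∀ i, -(B : ℤ) ≤ X i := by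
    refine ⟨∑ i, (X i).natAbs, fun i => ?_⟩
    have h2 := Finset.single_le_sum (f := fun i => (X i).natAbs)
      (fun _ _ => Nat.zero_le _) (Finset.mem_univ i)
    omega
  have hbound : ∀ k N : ℕ, K * (c + k * S) + k * B ≤ N → k * k ≤ compN V N := by
    intro k N hN
    obtain ⟨π, hπ, hlen, hval⟩ := hwalk k
    obtain ⟨w, hr⟩ := hπ.exists_run_repeat hK (B := B)
      (fun i => by
        rw [hval]
        have := mul_nonneg (Int.natCast_nonneg k) (hD i)
        linarith [hB i]) k (v := fun _ => N) (fun _ => by rwa [hlen])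
    refine le_trans (Nat.mul_le_mul_left k ?_) (hr.le_compN hterm ⟨hl₀, fun _ => le_rfl⟩)
    rw [hlen]
    nlinarith
  obtain ⟨A, hA⟩ : ∃ A : ℕ, A = K * c + K * S + B + 1 := ⟨_, rfl⟩
  have hApos : 0 < A := by omega
  have hApos' : (0 : ℝ) < A := by exact_mod_cast hApos
  refine ⟨1 / (2 * A) ^ 2, by positivity, A, fun N hN => ?_⟩
  have hk1 : 1 ≤ N / A := (Nat.one_le_div_iff hApos).2 hN
  have hk2 : A * (N / A) ≤ N := Nat.mul_div_le N A
  have hk3 : N < A * (N / A + 1) := Nat.lt_mul_div_succ N hApos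
  set k := N / A
  have h1 : k * k ≤ compN V N := hbound k N <| by
    have : K * c ≤ K * c * k := Nat.le_mul_of_pos_right _ hk1
    refine le_trans ?_ hk2
    rw [hA]
    nlinarith
  have h2 : N ≤ 2 * A * k := by nlinarith
  have h3 : (N : ℝ) ≤ 2 * A * k := by exact_mod_cast h2
  have h4 : (k : ℝ) * k ≤ compN V N := by exact_mod_cast h1
  refine le_trans ?_ h4
  rw [one_div, inv_mul_le_iff₀ (by positivity)]
  calc (N : ℝ) ^ 2 ≤ (2 * (A : ℝ) * k) ^ 2 := by gcongr
    _ = (2 * (A : ℝ)) ^ 2 * ((k : ℝ) * k) := by ring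

end VASSPaper
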